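/- arXiv:1612.04219 — 4 statements merged into one kernel-verified Lean document; each statement's English description precedes it below -/
import Mathlib

section
/- Let Γ be a finite set equipped with a reflexive and transitive binary relation ρ. Then the semigroups Γ(𝕋) and Γ(𝔽𝕋) satisfy exactly the same semigroup identities. -/
/-- The tropical (max-plus) semiring `𝕋 = ℝ ∪ {-∞}`, with `⊕ = max` and `⊗ = +`. -/
abbrev TT : Type := WithBot ℝ

/-- Tropical (max-plus) multiplication of square matrices over `𝕋`:
`(A ⊗ B) i j = max_k (A i k + B k j)`. -/
def tmul {ι : Type} [Fintype ι] (A B : Matrix ι ι TT) : Matrix ι ι TT :=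
  fun i j => Finset.univ.sup fun k => A i k + B k j

/-- The image of a word under the semigroup homomorphism from the free semigroup `Σ⁺`
to tropical matrices determined by the letter assignment `a` (junk value on the empty word). -/
def evalWord {ι σ : Type} [Fintype ι] (a : σ → Matrix ι ι TT) : List σ → Matrix ι ι TT
  | [] => fun _ _ => ⊥
  | h :: t => t.foldl (fun M s => tmul M (a s)) (a h)

/-- A tropical matrix is upper triangular if all entries strictly below the diagonal are `-∞`. -/
def IsUT {n : ℕ} (A : Matrix (Fin n) (Fin n) TT) : Prop :=
  ∀ i j : Fin n, j < i → A i j = ⊥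

/-- A family `M' N` of tropical matrices, `N ≥ 0`, approximates `M` from above if `M` has an upper
bound and `M ≤ M' N ≤ max M (C - N)` entrywise for some constant `C`. -/
def ApproxAbove {ι : Type} (M : Matrix ι ι TT) (M' : ℝ → Matrix ι ι TT) : Prop :=
  ∃ K C : ℝ, ∀ i j, M i j ≤ (K : TT) ∧
    ∀ N : ℝ, 0 ≤ N → M i j ≤ M' N i j ∧ M' N i j ≤ max (M i j) ((C - N : ℝ) : TT)

theorem ApproxAbove.tmul {ι : Type} [Fintype ι] {A B : Matrix ι ι TT} {A' B' : ℝ → Matrix ι ι TT}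
    (hA : ApproxAbove A A') (hB : ApproxAbove B B') :
    ApproxAbove (tmul A B) fun N => tmul (A' N) (B' N) := by
  obtain ⟨K, C, h⟩ := hA
  obtain ⟨L, D, h'⟩ := hB
  refine ⟨K + L, max (max (K + D) (C + L)) (C + D), fun i j => ⟨?_, fun N hN => ⟨?_, ?_⟩⟩⟩
  · refine Finset.sup_le fun k _ => ?_
    rw [WithBot.coe_add]
    exact add_le_add (h i k).1 (h' k j).1
  · exact Finset.sup_mono_fun fun k _ =>
      add_le_add ((h i k).2 N hN).1 ((h' k j).2 N hN).1
  · refine Finset.sup_le fun k _ => ?_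
    have hle : A i k + B k j ≤ _root_.tmul A B i j :=
      Finset.le_sup (f := fun k => A i k + B k j) (Finset.mem_univ k)
    refine (add_le_add ((h i k).2 N hN).2 ((h' k j).2 N hN).2).trans ?_
    rcases max_choice (A i k) ((C - N : ℝ) : TT) with e | e <;>
      rcases max_choice (B k j) ((D - N : ℝ) : TT) with e' | e' <;> rw [e, e']
    · exact le_max_of_le_left hle
    · refine le_max_of_le_right ((add_le_add (h i k).1 le_rfl).trans ?_)
      rw [← WithBot.coe_add, WithBot.coe_le_coe]
      linarith [le_max_left (K + D) (C + L), le_max_left (max (K + D) (C + L)) (C + D)]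
    · refine le_max_of_le_right ((add_le_add le_rfl (h' k j).1).trans ?_)
      rw [← WithBot.coe_add, WithBot.coe_le_coe]
      linarith [le_max_right (K + D) (C + L), le_max_left (max (K + D) (C + L)) (C + D)]
    · refine le_max_of_le_right ?_
      rw [← WithBot.coe_add, WithBot.coe_le_coe]
      linarith [le_max_right (max (K + D) (C + L)) (C + D)]

theorem ApproxAbove.foldl {ι σ : Type} [Fintype ι] {a : σ → Matrix ι ι TT}
    {a' : ℝ → σ → Matrix ι ι TT} (ha : ∀ s, ApproxAbove (a s) fun N => a' N s) (t : List σ) :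
    ∀ {M : Matrix ι ι TT} {M' : ℝ → Matrix ι ι TT}, ApproxAbove M M' →
      ApproxAbove (t.foldl (fun M s => _root_.tmul M (a s)) M)
        fun N => t.foldl (fun M s => _root_.tmul M (a' N s)) (M' N) := by
  induction t with
  | nil => exact fun h => h
  | cons s t ih => exact fun h => ih (h.tmul (ha s))

theorem ApproxAbove.evalWord {ι σ : Type} [Fintype ι] {a : σ → Matrix ι ι TT}
    {a' : ℝ → σ → Matrix ι ι TT} (ha : ∀ s, ApproxAbove (a s) fun N => a' N s) {w : List σ}
    (hw : w ≠ []) : ApproxAbove (evalWord a w) fun N => evalWord (a' N) w := by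
  cases w with
  | nil => exact absurd rfl hw
  | cons s t => exact ApproxAbove.foldl ha t (ha s)

/-- A matrix is determined by any family approximating it from above. -/
theorem ApproxAbove.le {ι : Type} {A B : Matrix ι ι TT} {M' : ℝ → Matrix ι ι TT}
    (hA : ApproxAbove A M') (hB : ApproxAbove B M') (i j : ι) : A i j ≤ B i j := by
  obtain ⟨_, _, h⟩ := hA
  obtain ⟨_, D, h'⟩ := hB
  cases hx : A i j using WithBot.recBotCoe with
  | bot => exact bot_le
  | coe x =>
    have hN : (0 : ℝ) ≤ max 0 (D - x + 1) := le_max_left _ _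
    have hle := ((h i j).2 _ hN).1.trans ((h' i j).2 _ hN).2
    rw [hx] at hle
    refine (le_max_iff.1 hle).resolve_right fun hc => ?_
    rw [WithBot.coe_le_coe] at hc
    linarith [le_max_right 0 (D - x + 1)]

open Classical in
/-- Raise every entry of `A` indexed by a pair in `r` to at least `-N`. -/
noncomputable def raiseEntries {ι : Type} (r : ι → ι → Prop) (A : Matrix ι ι TT) (N : ℝ) :
    Matrix ι ι TT :=
  fun i j => if r i j then max (A i j) ((-N : ℝ) : TT) else ⊥

theorem raiseEntries_ne_bot_iff {ι : Type} (r : ι → ι → Prop) (A : Matrix ι ι TT) (N : ℝ)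
    (i j : ι) : raiseEntries r A N i j ≠ ⊥ ↔ r i j := by
  by_cases h : r i j <;> simp [raiseEntries, h]

theorem approxAbove_raiseEntries {ι : Type} [Finite ι] {r : ι → ι → Prop} {A : Matrix ι ι TT}
    (hA : ∀ i j, A i j ≠ ⊥ → r i j) : ApproxAbove A (raiseEntries r A) := by
  obtain ⟨K, hK⟩ := (Set.finite_range fun p : ι × ι => (A p.1 p.2).unbotD 0).bddAbove
  refine ⟨K, 0, fun i j => ⟨?_, fun N _ => ?_⟩⟩
  · have hij := hK ⟨(i, j), rfl⟩
    cases hx : A i j using WithBot.recBotCoe with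
    | bot => exact bot_le
    | coe x => simpa [hx] using hij
  · by_cases h : r i j
    · simp [raiseEntries, h]
    · simp [raiseEntries, h, not_not.1 (mt (hA i j) h)]

/-- Let `Γ` be a finite set equipped with a reflexive transitive relation
`r`. Then `Γ(𝕋)` (functions `A : Γ × Γ → 𝕋` with `A_{i,j} ≠ -∞ → i r j`) and `Γ(𝔽𝕋)`
(those `A` with `A_{i,j} ≠ -∞ ↔ i r j`) satisfy exactly the same semigroup identities. -/
theorem stmt_16 (Γ : Type) [Fintype Γ] (r : Γ → Γ → Prop)
    (hrefl : ∀ i, r i i) (htrans : ∀ i j k, r i j → r j k → r i k)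
    (σ : Type) [Fintype σ] (u v : List σ) (hu : u ≠ []) (hv : v ≠ []) :
    (∀ a : σ → Matrix Γ Γ TT, (∀ s i j, a s i j ≠ ⊥ → r i j) →
      evalWord a u = evalWord a v)
    ↔ (∀ a : σ → Matrix Γ Γ TT, (∀ s i j, a s i j ≠ ⊥ ↔ r i j) →
        evalWord a u = evalWord a v) := by
  refine ⟨fun h a ha => h a fun s i j => (ha s i j).1, fun h a ha => ?_⟩
  have happ : ∀ s, ApproxAbove (a s) fun N => raiseEntries r (a s) N :=
    fun s => approxAbove_raiseEntries (ha s)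
  have hU := ApproxAbove.evalWord (a' := fun N s => raiseEntries r (a s) N) happ hu
  have hV := ApproxAbove.evalWord (a' := fun N s => raiseEntries r (a s) N) happ hv
  have heq : ∀ N, evalWord (fun s => raiseEntries r (a s) N) u =
      evalWord (fun s => raiseEntries r (a s) N) v :=
    fun N => h _ fun s => raiseEntries_ne_bot_iff r (a s) N
  simp only [heq] at hU
  ext i j
  exact le_antisymm (hU.le hV i j) (hV.le hU i j)
end

section
/- The map sending (i, j, k) ∈ ℐ to the 3 × 3 tropical matrix with rows (k, -∞, i), (-∞, -k, j), (-∞, -∞, 0) is an injective semigroup homomorphism from the free monogenic inverse monoid ℐ into UT_3(𝕋). -/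
/-- The carrier of the free monogenic inverse monoid `ℐ`:
triples `(i, j, k) ∈ ℤ³` with `i ≥ 0`, `j ≥ 0` and `-j ≤ k ≤ i`. -/
def ICar : Type :=
  {p : ℤ × ℤ × ℤ // 0 ≤ p.1 ∧ 0 ≤ p.2.1 ∧ -p.2.1 ≤ p.2.2 ∧ p.2.2 ≤ p.1}

/-- Multiplication of `ℐ`: `(i,j,k)(i',j',k') = (max(i, i'+k), max(j, j'-k), k+k')`. -/
def imul (p q : ICar) : ICar :=
  ⟨(max p.1.1 (q.1.1 + p.1.2.2), max p.1.2.1 (q.1.2.1 - p.1.2.2), p.1.2.2 + q.1.2.2), by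
    obtain ⟨⟨i, j, k⟩, hp⟩ := p
    obtain ⟨⟨i', j', k'⟩, hq⟩ := q
    obtain ⟨hi, hj, hk1, hk2⟩ := hp
    obtain ⟨hi', hj', hk1', hk2'⟩ := hq
    dsimp only at hi hj hk1 hk2 hi' hj' hk1' hk2' ⊢
    refine ⟨le_trans hi (le_max_left _ _), le_trans hj (le_max_left _ _), ?_, ?_⟩
    · have h1 := le_max_right j (j' - k)
      linarith
    · have h1 := le_max_right i (i' + k)
      linarith⟩

/-- The map sending `(i, j, k) ∈ ℐ` to the `3 × 3` tropical matrix with rows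
`(k, -∞, i)`, `(-∞, -k, j)`, `(-∞, -∞, 0)`. -/
def theta (p : ICar) : Matrix (Fin 3) (Fin 3) TT :=
  !![((p.1.2.2 : ℝ) : TT), ⊥, ((p.1.1 : ℝ) : TT);
     ⊥, ((-p.1.2.2 : ℝ) : TT), ((p.1.2.1 : ℝ) : TT);
     ⊥, ⊥, (0 : TT)]

/-- The map sending `(i, j, k) ∈ ℐ` to the `3 × 3` tropical matrix with rows
`(k, -∞, i)`, `(-∞, -k, j)`, `(-∞, -∞, 0)` is an injective semigroup homomorphism from the
free monogenic inverse monoid `ℐ` into `UT_3(𝕋)`. -/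
theorem stmt_17 :
    Function.Injective theta ∧ (∀ p, IsUT (theta p)) ∧
      ∀ p q : ICar, theta (imul p q) = tmul (theta p) (theta q) := by
  refine ⟨fun p q h => ?_, fun p i j hij => ?_, fun p q => ?_⟩
  · have h0 := congrFun (congrFun h 0) 0
    have h1 := congrFun (congrFun h 0) 2
    have h2 := congrFun (congrFun h 1) 2
    simp [theta] at h0 h1 h2
    exact Subtype.ext (Prod.ext h1 (Prod.ext h2 h0))
  · fin_cases i <;> fin_cases j <;> simp_all [theta]
  · have huniv : (Finset.univ : Finset (Fin 3)) = {0, 1, 2} := rfl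
    refine Matrix.ext fun i j => ?_
    rw [tmul, huniv, Finset.sup_insert, Finset.sup_insert, Finset.sup_singleton]
    fin_cases i <;> fin_cases j <;> simp [theta, imul]
    · rw [max_comm, add_comm]
    · rw [add_comm]
    · rw [max_comm, ← WithBot.coe_add, sub_eq_add_neg, add_comm]
end

section
/- There exists an injective semigroup homomorphism from the free monogenic inverse monoid ℐ into UT_n(𝕋) if and only if n ≥ 3. -/
theorem withBot_eq_bot_or_zero_of_add_self {a : TT} (h : a + a = a) : a = ⊥ ∨ a = 0 := by
  induction a using WithBot.recBotCoe with
  | bot => exact Or.inl rfl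
  | coe x =>
    right
    have hx : x + x = x := by exact_mod_cast h
    have hx0 : x = 0 := by linarith
    rw [hx0]
    rfl

theorem diag_eq_of_add_self {a b : TT} (ha : a + a = a) (hb : b + b = b)
    (h : a = ⊥ ↔ b = ⊥) : a = b := by
  rcases withBot_eq_bot_or_zero_of_add_self ha with rfl | rfl
  · exact (h.1 rfl).symm
  · rcases withBot_eq_bot_or_zero_of_add_self hb with rfl | rfl
    · exact h.2 rfl
    · rfl

theorem tmul_fin_two (A B : Matrix (Fin 2) (Fin 2) TT) (i j : Fin 2) :
    tmul A B i j = (A i 0 + B 0 j) ⊔ (A i 1 + B 1 j) := by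
  simp [tmul, Fin.univ_succ]

/-- In `UT_n(𝕋)` with `n ≤ 2`, the product of two idempotents whose diagonals have the same
support is one of the two factors. -/
theorem tmul_eq_left_or_right_of_idempotent {n : ℕ} (hn : n < 3) {A B : Matrix (Fin n) (Fin n) TT}
    (hAu : IsUT A) (hBu : IsUT B) (hA : tmul A A = A) (hB : tmul B B = B)
    (h : ∀ i, A i i = ⊥ ↔ B i i = ⊥) : tmul A B = A ∨ tmul A B = B := by
  interval_cases n
  · left
    ext i
    exact i.elim0
  · have ha : A 0 0 + A 0 0 = A 0 0 := by simpa [tmul] using congrFun (congrFun hA 0) 0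
    have hb : B 0 0 + B 0 0 = B 0 0 := by simpa [tmul] using congrFun (congrFun hB 0) 0
    have hAB : A = B := by
      funext i j
      rw [Subsingleton.elim i 0, Subsingleton.elim j 0]
      exact diag_eq_of_add_self ha hb (h 0)
    left
    rw [← hAB, hA]
  · have hA1 : A 1 0 = ⊥ := hAu 1 0 (by decide)
    have hB1 : B 1 0 = ⊥ := hBu 1 0 (by decide)
    have key : ∀ {C : Matrix (Fin 2) (Fin 2) TT}, C 1 0 = ⊥ → tmul C C = C →
        C 0 0 + C 0 0 = C 0 0 ∧ C 1 1 + C 1 1 = C 1 1 ∧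
          (C 0 0 + C 0 1) ⊔ (C 0 1 + C 1 1) = C 0 1 := by
      intro C hC hCC
      have hs := fun i j => (tmul_fin_two C C i j).symm.trans (congrFun (congrFun hCC i) j)
      exact ⟨by simpa [hC] using hs 0 0, by simpa [hC] using hs 1 1, hs 0 1⟩
    obtain ⟨a0, a1, a01⟩ := key hA1 hA
    obtain ⟨b0, b1, b01⟩ := key hB1 hB
    have e0 := diag_eq_of_add_self a0 b0 (h 0)
    have e1 := diag_eq_of_add_self a1 b1 (h 1)
    have reduce : ∀ {C : Matrix (Fin 2) (Fin 2) TT}, A 0 0 = C 0 0 → A 1 1 = C 1 1 →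
        C 1 0 = ⊥ → (A 0 0 + B 0 1) ⊔ (A 0 1 + B 1 1) = C 0 1 → tmul A B = C := by
      intro C h0 h1 h10 h01
      funext i j
      fin_cases i <;> fin_cases j <;> simp only [Fin.zero_eta, Fin.mk_one, tmul_fin_two]
      · rw [hB1, ← e0, a0, h0]; simp
      · exact h01
      · rw [hA1, hB1, h10]; simp
      · rw [hA1, ← e1, a1, h1]; simp
    suffices hs : (A 0 0 + B 0 1) ⊔ (A 0 1 + B 1 1) = A 0 1 ∨
        (A 0 0 + B 0 1) ⊔ (A 0 1 + B 1 1) = B 0 1 from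
      hs.imp (reduce rfl rfl hA1) (reduce e0 e1 hB1)
    rw [← e0, ← e1] at b01
    rw [← e1]
    rcases withBot_eq_bot_or_zero_of_add_self a0 with z0 | z0 <;>
      rcases withBot_eq_bot_or_zero_of_add_self a1 with z1 | z1 <;>
      simp only [z0, z1, WithBot.bot_add, WithBot.add_bot, zero_add, add_zero, bot_sup_eq,
        sup_bot_eq] at a01 b01 ⊢
    · exact Or.inl a01
    · simp
    · simp
    · rcases le_total (B 0 1) (A 0 1) with hle | hle
      · exact Or.inl (sup_eq_right.2 hle)
      · exact Or.inr (sup_eq_left.2 hle)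

/-- The idempotent `(i, j, 0)` of `ℐ`. -/
def idem (i j : ℕ) : ICar := ⟨(i, j, 0), by simp⟩

theorem imul_idem (i j i' j' : ℕ) :
    imul (idem i j) (idem i' j') = idem (max i i') (max j j') := by
  apply Subtype.ext
  simp [imul, idem]

theorem idem_inj {i j i' j' : ℕ} : idem i j = idem i' j' ↔ i = i' ∧ j = j' := by
  refine Subtype.ext_iff.trans ?_
  simp [idem]

theorem theta_imul (p q : ICar) : theta (imul p q) = tmul (theta p) (theta q) := by
  funext i j
  fin_cases i <;> fin_cases j <;>
    simp [theta, imul, tmul, Fin.univ_succ, ← WithBot.coe_add, max_comm, add_comm, sub_eq_add_neg]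

theorem theta_injective : Function.Injective theta := by
  intro p q h
  have h0 := congrFun (congrFun h 0) 2
  have h1 := congrFun (congrFun h 1) 2
  have h2 := congrFun (congrFun h 0) 0
  simp only [theta, Matrix.of_apply, Matrix.cons_val', Matrix.cons_val, WithBot.coe_inj,
    Int.cast_inj] at h0 h1 h2
  exact Subtype.ext (Prod.ext h0 (Prod.ext h1 h2))

theorem theta_isUT (p : ICar) : IsUT (theta p) := by
  intro i j h
  fin_cases i <;> fin_cases j <;> simp_all [theta]

/-- Extend an `m × m` matrix to an `n × n` matrix by entries `-∞`. -/
def pad {m : ℕ} (n : ℕ) (A : Matrix (Fin m) (Fin m) TT) : Matrix (Fin n) (Fin n) TT :=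
  fun i j => if h : i.1 < m ∧ j.1 < m then A ⟨i, h.1⟩ ⟨j, h.2⟩ else ⊥

theorem pad_castLE {m n : ℕ} (hmn : m ≤ n) (A : Matrix (Fin m) (Fin m) TT) (i j : Fin m) :
    pad n A (i.castLE hmn) (j.castLE hmn) = A i j := by
  simp [pad]

theorem pad_injective {m n : ℕ} (hmn : m ≤ n) :
    Function.Injective (pad n : Matrix (Fin m) (Fin m) TT → _) := by
  intro A B h
  ext i j
  rw [← pad_castLE hmn A, h, pad_castLE]

theorem pad_isUT {m n : ℕ} {A : Matrix (Fin m) (Fin m) TT} (hA : IsUT A) : IsUT (pad n A) := by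
  intro i j hij
  unfold pad
  split_ifs with h
  · exact hA _ _ hij
  · rfl

theorem pad_tmul {m n : ℕ} (hmn : m ≤ n) (A B : Matrix (Fin m) (Fin m) TT) :
    pad n (tmul A B) = tmul (pad n A) (pad n B) := by
  funext i j
  apply le_antisymm
  · by_cases h : i.1 < m ∧ j.1 < m
    · rw [pad, dif_pos h]
      refine Finset.sup_le fun k _ => ?_
      refine le_trans (le_of_eq ?_) (Finset.le_sup (Finset.mem_univ (k.castLE hmn)))
      simp [pad, h]
    · rw [pad, dif_neg h]
      exact bot_le
  · refine Finset.sup_le fun k _ => ?_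
    by_cases hi : i.1 < m <;> by_cases hj : j.1 < m <;> by_cases hk : k.1 < m <;>
      simp only [pad, hi, hj, hk, and_self, and_true, and_false, dite_true,
        dite_false, WithBot.bot_add, WithBot.add_bot, bot_le, le_refl]
    exact Finset.le_sup (f := fun k => A ⟨i, hi⟩ k + B k ⟨j, hj⟩)
      (Finset.mem_univ (⟨k, hk⟩ : Fin m))

/-- There exists an injective semigroup homomorphism from the free monogenic
inverse monoid `ℐ` into `UT_n(𝕋)` if and only if `n ≥ 3`. -/
theorem stmt_18 (n : ℕ) :
    (∃ f : ICar → Matrix (Fin n) (Fin n) TT,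
      Function.Injective f ∧ (∀ p, IsUT (f p)) ∧
        ∀ p q : ICar, f (imul p q) = tmul (f p) (f q)) ↔ 3 ≤ n := by
  constructor
  · rintro ⟨f, hinj, hut, hmul⟩
    by_contra! hn
    have hidem (i j : ℕ) : tmul (f (idem i j)) (f (idem i j)) = f (idem i j) := by
      rw [← hmul, imul_idem, max_self, max_self]
    classical
    obtain ⟨x, y, hxy, hsupp⟩ := Fintype.exists_ne_map_eq_of_card_lt
      (fun (x : Fin 5) (i : Fin n) => decide (f (idem x (4 - x)) i i = ⊥)) (by
        have : 2 ^ n ≤ 2 ^ 2 := Nat.pow_le_pow_right (by norm_num) (by omega)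
        simp only [Fintype.card_pi, Fintype.card_bool, Finset.prod_const, Finset.card_univ,
          Fintype.card_fin]
        omega)
    have hne : (x : ℕ) ≠ y := fun h => hxy (Fin.ext h)
    rcases tmul_eq_left_or_right_of_idempotent hn (hut _) (hut _) (hidem x (4 - x))
      (hidem y (4 - y)) (fun i => by simpa using congrFun hsupp i) with h | h <;>
    · rw [← hmul, imul_idem] at h
      have := idem_inj.1 (hinj h)
      omega
  · intro hn
    exact ⟨fun p => pad n (theta p), (pad_injective hn).comp theta_injective,
      fun p => pad_isUT (theta_isUT p),
      fun p q => (congrArg (pad n) (theta_imul p q)).trans (pad_tmul hn _ _)⟩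
end

section
/- Let Γ be a finite partially ordered set. For each chain ρ in Γ define ψ_ρ : Γ(𝕋) → 𝕋^{ρ×ρ} by ψ_ρ(M)_{i,j} = M_{i,j} for i, j on ρ, and for a family D = (D_ρ)_ρ indexed by the chains of Γ define φ(D)_{i,j} = max over chains ρ containing both i and j of (D_ρ)_{i,j} (with max over the empty set equal to -∞). Then for all k ≥ 1 and all M_1, ..., M_k ∈ Γ(𝕋), applying φ to the family whose ρ-component is the tropical matrix product ψ_ρ(M_1) ⊗ ... ⊗ ψ_ρ(M_k) yields exactly M_1 ⊗ ... ⊗ M_k; in particular φ is a surjective semigroup homomorphism from the subsemigroup generated by the image of ψ = (ψ_ρ)_ρ in the direct product of the semigroups of ρ-indexed upper triangular tropical matrices onto Γ(𝕋). -/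
/-- The chains of a finite poset `Γ`: strictly increasing sequences of (necessarily at most
`|Γ|`) elements of `Γ`. -/
abbrev ChainsOf (Γ : Type) [Fintype Γ] [PartialOrder Γ] : Type :=
  Σ m : Fin (Fintype.card Γ + 1), {c : Fin (m : ℕ) → Γ // ∀ p q, p < q → c p < c q}

/-- `ψ_ρ` : the restriction of a `Γ × Γ` tropical matrix to the chain `ρ`. -/
def psiC {Γ : Type} [Fintype Γ] [PartialOrder Γ] (ρ : ChainsOf Γ) (M : Matrix Γ Γ TT) :
    Matrix (Fin (ρ.1 : ℕ)) (Fin (ρ.1 : ℕ)) TT :=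
  fun p q => M (ρ.2.1 p) (ρ.2.1 q)

/-- The tropical product `A₁ ⊗ ⋯ ⊗ A_k` of a list of matrices (junk value on `[]`). -/
def listProd {ι : Type} [Fintype ι] : List (Matrix ι ι TT) → Matrix ι ι TT
  | [] => fun _ _ => ⊥
  | A :: t => t.foldl tmul A

/-- `φ` : given a family `D` of matrices indexed by the chains of `Γ`, `φ(D)_{i,j}` is the
maximum over all chains `ρ` containing both `i` and `j` of `(D_ρ)_{i,j}` (with the maximum
over the empty set equal to `-∞`). -/
def phiC {Γ : Type} [Fintype Γ] [PartialOrder Γ] [DecidableEq Γ]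
    [DecidableRel ((· < ·) : Γ → Γ → Prop)]
    (D : ∀ ρ : ChainsOf Γ, Matrix (Fin (ρ.1 : ℕ)) (Fin (ρ.1 : ℕ)) TT) : Matrix Γ Γ TT :=
  fun i j => Finset.univ.sup fun ρ : ChainsOf Γ =>
    Finset.univ.sup fun pq : Fin (ρ.1 : ℕ) × Fin (ρ.1 : ℕ) =>
      if ρ.2.1 pq.1 = i ∧ ρ.2.1 pq.2 = j then D ρ pq.1 pq.2 else ⊥

/-- The subsemigroup of the direct product `Δ = ∏_ρ Δ_ρ` generated by the image of
`ψ = (ψ_ρ)_ρ` : all families arising as componentwise products `ψ(M₁) ⋯ ψ(M_k)` with each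
`M_l ∈ Γ(𝕋)`. -/
def genSet (Γ : Type) [Fintype Γ] [PartialOrder Γ] :
    Set (∀ ρ : ChainsOf Γ, Matrix (Fin (ρ.1 : ℕ)) (Fin (ρ.1 : ℕ)) TT) :=
  {D | ∃ ms : List (Matrix Γ Γ TT), ms ≠ [] ∧
    (∀ A ∈ ms, ∀ i j, ¬ i ≤ j → A i j = ⊥) ∧
    D = fun ρ => listProd (ms.map (psiC ρ))}

section TropicalProducts

variable {ι : Type} [Fintype ι]

lemma le_tmul (A B : Matrix ι ι TT) (i k j : ι) : A i k + B k j ≤ tmul A B i j :=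
  Finset.le_sup (f := fun k => A i k + B k j) (Finset.mem_univ k)

lemma exists_tmul_eq (A B : Matrix ι ι TT) (i j : ι) :
    ∃ k, tmul A B i j = A i k + B k j := by
  obtain ⟨k, -, hk⟩ := Finset.exists_mem_eq_sup Finset.univ ⟨i, Finset.mem_univ i⟩
    fun k => A i k + B k j
  exact ⟨k, hk⟩

lemma tmul_assoc (A B C : Matrix ι ι TT) : tmul (tmul A B) C = tmul A (tmul B C) := by
  ext i j : 2
  apply le_antisymm
  · obtain ⟨k, hk⟩ := exists_tmul_eq (tmul A B) C i j
    obtain ⟨l, hl⟩ := exists_tmul_eq A B i k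
    rw [hk, hl, add_assoc]
    exact (add_le_add le_rfl (le_tmul B C l k j)).trans (le_tmul A _ i l j)
  · obtain ⟨k, hk⟩ := exists_tmul_eq A (tmul B C) i j
    obtain ⟨l, hl⟩ := exists_tmul_eq B C k j
    rw [hk, hl, ← add_assoc]
    exact (add_le_add (le_tmul A B i k l) le_rfl).trans (le_tmul _ C i l j)

lemma listProd_concat {l : List (Matrix ι ι TT)} (hl : l ≠ []) (A : Matrix ι ι TT) :
    listProd (l ++ [A]) = tmul (listProd l) A := by
  cases l with
  | nil => exact absurd rfl hl
  | cons B t => simp [listProd]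

lemma listProd_append {l l' : List (Matrix ι ι TT)} (hl : l ≠ []) (hl' : l' ≠ []) :
    listProd (l ++ l') = tmul (listProd l) (listProd l') := by
  induction l' using List.reverseRecOn with
  | nil => exact absurd rfl hl'
  | append_singleton t A ih =>
    rcases eq_or_ne t [] with rfl | ht
    · exact listProd_concat hl A
    · rw [← List.append_assoc, listProd_concat (by simp [hl]), ih ht, listProd_concat ht,
        tmul_assoc]

lemma listProd_submatrix_le {κ : Type} [Fintype κ] (c : κ → ι) (ms : List (Matrix ι ι TT))
    (p q : κ) :
    listProd (ms.map fun M => M.submatrix c c) p q ≤ listProd ms (c p) (c q) := by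
  induction ms using List.reverseRecOn generalizing p q with
  | nil => exact bot_le
  | append_singleton t A ih =>
    rcases eq_or_ne t [] with rfl | ht
    · exact le_rfl
    · rw [List.map_append, List.map_singleton, listProd_concat (by simpa using ht),
        listProd_concat ht]
      obtain ⟨k, hk⟩ := exists_tmul_eq
        (listProd (t.map fun M => M.submatrix c c)) (A.submatrix c c) p q
      rw [hk]
      exact (add_le_add (ih p k) le_rfl).trans (le_tmul _ A (c p) (c k) (c q))

/-- A finite entry of a product of matrices supported on `≤` is attained along a chain: it is
bounded by the same entry of the product restricted to any index family covering that chain. -/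
lemma exists_chain_listProd_le [PartialOrder ι] (ms : List (Matrix ι ι TT)) (hms : ms ≠ [])
    (hA : ∀ A ∈ ms, ∀ i j, ¬ i ≤ j → A i j = ⊥) (i j : ι) (hij : listProd ms i j ≠ ⊥) :
    ∃ l : List ι, l.Pairwise (· < ·) ∧ i ∈ l ∧ j ∈ l ∧ (∀ x ∈ l, x ≤ j) ∧
      ∀ {κ : Type} [Fintype κ] (c : κ → ι), (∀ x ∈ l, x ∈ Set.range c) →
        ∀ p q, c p = i → c q = j →
          listProd ms i j ≤ listProd (ms.map fun M => M.submatrix c c) p q := by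
  induction ms using List.reverseRecOn generalizing j with
  | nil => exact absurd rfl hms
  | append_singleton t A ih =>
    rcases eq_or_ne t [] with rfl | ht
    · have hle : i ≤ j := by
        by_contra h
        exact hij (hA A (by simp) i j h)
      have hentry {κ : Type} [Fintype κ] (c : κ → ι) (p q : κ) (hp : c p = i) (hq : c q = j) :
          listProd ([] ++ [A]) i j ≤
            listProd (([] ++ [A]).map fun M : Matrix ι ι TT => M.submatrix c c) p q := by
        subst hp hq
        exact le_rfl
      rcases hle.eq_or_lt with rfl | hlt
      · exact ⟨[i], by simp, by simp, by simp, by simp, fun c _ => hentry c⟩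
      · exact ⟨[i, j], by simpa using hlt, by simp, by simp, by simpa using hle,
          fun c _ => hentry c⟩
    · rw [listProd_concat ht] at hij ⊢
      obtain ⟨k, hk⟩ := exists_tmul_eq (listProd t) A i j
      rw [hk] at hij ⊢
      obtain ⟨hik, hkj⟩ := WithBot.add_ne_bot.1 hij
      have hle : k ≤ j := by
        by_contra h
        exact hkj (hA A (by simp) k j h)
      obtain ⟨l, hl, hil, hkl, hmax, hbound⟩ :=
        ih ht (fun B hB => hA B (List.mem_append_left _ hB)) k hik
      have hentry {κ : Type} [Fintype κ] (c : κ → ι) (hc : ∀ x ∈ l, x ∈ Set.range c) (p q : κ)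
          (hp : c p = i) (hq : c q = j) : listProd t i k + A k j ≤
            listProd ((t ++ [A]).map fun M => M.submatrix c c) p q := by
        obtain ⟨r, hr⟩ := hc k hkl
        rw [List.map_append, List.map_singleton, listProd_concat (by simpa using ht)]
        refine (add_le_add (hbound c hc p r hp hr) ?_).trans
          (le_tmul _ (A.submatrix c c) p r q)
        rw [Matrix.submatrix_apply, hr, hq]
      rcases hle.eq_or_lt with rfl | hlt
      · exact ⟨l, hl, hil, hkl, hmax, fun c hc => hentry c hc⟩
      · refine ⟨l ++ [j], ?_, by simp [hil], by simp, ?_,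
          fun c hc => hentry c fun x hx => hc x (List.mem_append_left _ hx)⟩
        · rw [List.pairwise_append]
          refine ⟨hl, by simp, fun x hx y hy => ?_⟩
          rw [List.mem_singleton.1 hy]
          exact (hmax x hx).trans_lt hlt
        · intro x hx
          rcases List.mem_append.1 hx with hx | hx
          · exact (hmax x hx).trans hle
          · exact (List.mem_singleton.1 hx).le

end TropicalProducts

section Chains

variable {Γ : Type} [Fintype Γ] [PartialOrder Γ]

/-- The chain whose elements are listed by a strictly increasing list. -/
def chainOfList (l : List Γ) (hl : l.Pairwise (· < ·)) : ChainsOf Γ :=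
  ⟨⟨l.length, Nat.lt_succ_of_le (List.Nodup.length_le_card (hl.imp ne_of_lt))⟩, l.get,
    fun _ _ h => List.pairwise_iff_get.1 hl _ _ h⟩

variable [DecidableEq Γ] [DecidableRel ((· < ·) : Γ → Γ → Prop)]

lemma le_phiC (D : ∀ ρ : ChainsOf Γ, Matrix (Fin (ρ.1 : ℕ)) (Fin (ρ.1 : ℕ)) TT)
    (ρ : ChainsOf Γ) (p q : Fin (ρ.1 : ℕ)) : D ρ p q ≤ phiC D (ρ.2.1 p) (ρ.2.1 q) := by
  refine le_trans ?_ (Finset.le_sup (Finset.mem_univ ρ))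
  refine le_trans ?_ (Finset.le_sup (Finset.mem_univ (p, q)))
  simp

lemma phiC_le {D : ∀ ρ : ChainsOf Γ, Matrix (Fin (ρ.1 : ℕ)) (Fin (ρ.1 : ℕ)) TT}
    {M : Matrix Γ Γ TT} (h : ∀ ρ p q, D ρ p q ≤ M (ρ.2.1 p) (ρ.2.1 q)) (i j : Γ) :
    phiC D i j ≤ M i j := by
  refine Finset.sup_le fun ρ _ => Finset.sup_le fun pq _ => ?_
  split_ifs with hpq
  · rw [← hpq.1, ← hpq.2]
    exact h ρ pq.1 pq.2
  · exact bot_le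

lemma phiC_listProd_psiC (ms : List (Matrix Γ Γ TT)) (hms : ms ≠ [])
    (hA : ∀ A ∈ ms, ∀ i j, ¬ i ≤ j → A i j = ⊥) :
    phiC (fun ρ => listProd (ms.map (psiC ρ))) = listProd ms := by
  ext i j : 2
  refine le_antisymm (phiC_le (fun ρ => listProd_submatrix_le ρ.2.1 ms) i j) ?_
  by_cases hij : listProd ms i j = ⊥
  · exact hij ▸ bot_le
  obtain ⟨l, hl, hil, hjl, -, hbound⟩ := exists_chain_listProd_le ms hms hA i j hij
  obtain ⟨p, hp⟩ := List.get_of_mem hil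
  obtain ⟨q, hq⟩ := List.get_of_mem hjl
  refine (hbound l.get (fun x hx => List.get_of_mem hx) p q hp hq).trans ?_
  have h := le_phiC (fun ρ => listProd (ms.map (psiC ρ))) (chainOfList l hl) p q
  rwa [show (chainOfList l hl).2.1 p = i from hp,
    show (chainOfList l hl).2.1 q = j from hq] at h

end Chains

/-- For any `k ≥ 1` matrices `M₁, …, M_k ∈ Γ(𝕋)` (given as a nonempty list
`ms`), applying `φ` to the family whose `ρ`-component is `ψ_ρ(M₁) ⊗ ⋯ ⊗ ψ_ρ(M_k)` yields
exactly `M₁ ⊗ ⋯ ⊗ M_k`; in particular `φ` is a semigroup homomorphism from the subsemigroup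
generated by the image of `ψ` onto `Γ(𝕋)` (it respects componentwise products and is
surjective onto `Γ(𝕋)`). -/
theorem stmt_19 (Γ : Type) [Fintype Γ] [PartialOrder Γ] [DecidableEq Γ]
    [DecidableRel ((· < ·) : Γ → Γ → Prop)] :
    (∀ ms : List (Matrix Γ Γ TT), ms ≠ [] →
      (∀ A ∈ ms, ∀ i j, ¬ i ≤ j → A i j = ⊥) →
      phiC (fun ρ => listProd (ms.map (psiC ρ))) = listProd ms)
    ∧ (∀ D D' : ∀ ρ : ChainsOf Γ, Matrix (Fin (ρ.1 : ℕ)) (Fin (ρ.1 : ℕ)) TT,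
        D ∈ genSet Γ → D' ∈ genSet Γ →
        phiC (fun ρ => tmul (D ρ) (D' ρ)) = tmul (phiC D) (phiC D'))
    ∧ (∀ M : Matrix Γ Γ TT, (∀ i j, ¬ i ≤ j → M i j = ⊥) →
        ∃ D ∈ genSet Γ, phiC D = M) := by
  refine ⟨phiC_listProd_psiC, ?_, fun M hM => ⟨fun ρ => listProd ([M].map (psiC ρ)),
    ⟨[M], by simp, by simpa using hM, rfl⟩, phiC_listProd_psiC [M] (by simp) (by simpa using hM)⟩⟩
  rintro _ _ ⟨ms, hms, hA, rfl⟩ ⟨ms', hms', hA', rfl⟩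
  rw [phiC_listProd_psiC ms hms hA, phiC_listProd_psiC ms' hms' hA', ← listProd_append hms hms',
    ← phiC_listProd_psiC (ms ++ ms') (by simp [hms])
      fun A h => (List.mem_append.1 h).elim (hA A) (hA' A)]
  congr 1
  ext ρ : 1
  rw [List.map_append, listProd_append (by simpa using hms) (by simpa using hms')]
end
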